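/- The function f_a is continuous at every point of [0,1] if and only if a = 0 or a = 1. Equivalently, if the s-adic digit sequence (a_n) of a is neither constantly 0 nor constantly s−1, then f_a has a point of discontinuity, which is necessarily a Q*_s-binary number; while f_0 and f_1 are continuous on all of [0,1]. -/

import Mathlib

open Filter Topology MeasureTheory Set

set_option linter.unusedVariables false

/-- β_{k,n} = Σ_{i<k} q_{i,n}. -/
noncomputable def qbeta (s : ℕ) (q : Fin s → ℕ → ℝ) (k : Fin s) (n : ℕ) : ℝ :=
  ∑ i : Fin s, if i < k then q i n else 0

/-- Δ(α) = β_{α_1,1} + Σ_{n≥2} β_{α_n,n} Π_{j<n} q_{α_j,j}, with positions indexed from 0. -/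
noncomputable def Delta (s : ℕ) (q : Fin s → ℕ → ℝ) (α : ℕ → Fin s) : ℝ :=
  ∑' n : ℕ, qbeta s q (α n) n * ∏ j ∈ Finset.range n, q (α j) j

/-- the digit |a − b|. -/
def adiff {s : ℕ} (a b : Fin s) : Fin s :=
  ⟨a.1 - b.1 + (b.1 - a.1), by have ha := a.2; have hb := b.2; omega⟩

section QStar

variable {s : ℕ} {q : Fin s → ℕ → ℝ}

/-- The length of the rank `N` cylinder of `α`. -/
noncomputable def cylLen (q : Fin s → ℕ → ℝ) (α : ℕ → Fin s) (N : ℕ) : ℝ :=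
  ∏ j ∈ Finset.range N, q (α j) j

/-- The left endpoint of the rank `N` cylinder of `α`. -/
noncomputable def cylLeft (q : Fin s → ℕ → ℝ) (α : ℕ → Fin s) (N : ℕ) : ℝ :=
  ∑ n ∈ Finset.range N, qbeta s q (α n) n * cylLen q α n

lemma qbeta_eq_sum_Iio (k : Fin s) (n : ℕ) : qbeta s q k n = ∑ i ∈ Finset.Iio k, q i n := by
  rw [qbeta, ← Finset.sum_filter]
  congr 1
  ext i
  simp

lemma qbeta_add_eq_sum_Iic (k : Fin s) (n : ℕ) :
    qbeta s q k n + q k n = ∑ i ∈ Finset.Iic k, q i n := by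
  rw [qbeta_eq_sum_Iio, ← Finset.Iio_insert, Finset.sum_insert (by simp), add_comm]

lemma qbeta_nonneg (hq0 : ∀ i n, 0 < q i n) (k : Fin s) (n : ℕ) : 0 ≤ qbeta s q k n := by
  rw [qbeta_eq_sum_Iio]
  exact Finset.sum_nonneg fun i _ => (hq0 i n).le

lemma qbeta_eq_zero {k : Fin s} (hk : (k : ℕ) = 0) (n : ℕ) : qbeta s q k n = 0 := by
  rw [qbeta_eq_sum_Iio]
  refine Finset.sum_eq_zero fun i hi => ?_
  have := Fin.lt_def.1 (Finset.mem_Iio.1 hi)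
  omega

lemma qbeta_pos (hq0 : ∀ i n, 0 < q i n) {k : Fin s} (hk : (k : ℕ) ≠ 0) (n : ℕ) :
    0 < qbeta s q k n := by
  rw [qbeta_eq_sum_Iio]
  refine Finset.sum_pos (fun i _ => hq0 i n) ⟨⟨0, k.pos⟩, ?_⟩
  rw [Finset.mem_Iio, Fin.lt_def]
  exact Nat.pos_of_ne_zero hk

lemma qbeta_add_le_one (hq0 : ∀ i n, 0 < q i n) (hqsum : ∀ n, ∑ i : Fin s, q i n = 1)
    (k : Fin s) (n : ℕ) : qbeta s q k n + q k n ≤ 1 := by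
  rw [qbeta_add_eq_sum_Iic, ← hqsum n]
  exact Finset.sum_le_sum_of_subset_of_nonneg (Finset.subset_univ _) fun i _ _ => (hq0 i n).le

lemma qbeta_add_eq_one (hqsum : ∀ n, ∑ i : Fin s, q i n = 1) {k : Fin s}
    (hk : (k : ℕ) + 1 = s) (n : ℕ) : qbeta s q k n + q k n = 1 := by
  rw [qbeta_add_eq_sum_Iic, ← hqsum n]
  congr 1
  ext i
  simp only [Finset.mem_Iic, Finset.mem_univ, iff_true, Fin.le_def]
  omega

lemma qbeta_add_lt_one (hq0 : ∀ i n, 0 < q i n) (hqsum : ∀ n, ∑ i : Fin s, q i n = 1)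
    {k : Fin s} (hk : (k : ℕ) + 1 ≠ s) (n : ℕ) : qbeta s q k n + q k n < 1 := by
  rw [qbeta_add_eq_sum_Iic, ← hqsum n]
  refine Finset.sum_lt_sum_of_subset (Finset.subset_univ _)
    (Finset.mem_univ (⟨k + 1, by omega⟩ : Fin s)) ?_ (hq0 _ n) fun i _ _ => (hq0 i n).le
  simp [Fin.le_def]

lemma qbeta_add_le_qbeta (hq0 : ∀ i n, 0 < q i n) {k l : Fin s} (hkl : k < l) (n : ℕ) :
    qbeta s q k n + q k n ≤ qbeta s q l n := by
  rw [qbeta_add_eq_sum_Iic, qbeta_eq_sum_Iio]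
  refine Finset.sum_le_sum_of_subset_of_nonneg (fun i hi => ?_) fun i _ _ => (hq0 i n).le
  exact Finset.mem_Iio.2 ((Finset.mem_Iic.1 hi).trans_lt hkl)

lemma qbeta_add_eq_qbeta {k l : Fin s} (hkl : (k : ℕ) + 1 = l) (n : ℕ) :
    qbeta s q k n + q k n = qbeta s q l n := by
  rw [qbeta_add_eq_sum_Iic, qbeta_eq_sum_Iio]
  congr 1
  ext i
  simp only [Finset.mem_Iic, Finset.mem_Iio, Fin.le_def, Fin.lt_def]
  omega

lemma qbeta_add_lt_qbeta (hq0 : ∀ i n, 0 < q i n) {k l : Fin s} (hkl : (k : ℕ) + 1 < l)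
    (n : ℕ) : qbeta s q k n + q k n < qbeta s q l n := by
  rw [qbeta_add_eq_sum_Iic, qbeta_eq_sum_Iio]
  refine Finset.sum_lt_sum_of_subset (i := ⟨k + 1, by omega⟩) (fun i hi => ?_) ?_ ?_ (hq0 _ n)
    fun i _ _ => (hq0 i n).le
  · have := Fin.le_def.1 (Finset.mem_Iic.1 hi)
    rw [Finset.mem_Iio, Fin.lt_def]
    omega
  · simpa [Fin.lt_def] using hkl
  · simp [Fin.le_def]

lemma cylLen_pos (hq0 : ∀ i n, 0 < q i n) (α : ℕ → Fin s) (N : ℕ) : 0 < cylLen q α N :=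
  Finset.prod_pos fun j _ => hq0 _ j

lemma cylLen_succ (α : ℕ → Fin s) (N : ℕ) : cylLen q α (N + 1) = cylLen q α N * q (α N) N :=
  Finset.prod_range_succ _ _

lemma cylLeft_succ (α : ℕ → Fin s) (N : ℕ) :
    cylLeft q α (N + 1) = cylLeft q α N + qbeta s q (α N) N * cylLen q α N :=
  Finset.sum_range_succ _ _

lemma cylRight_succ (α : ℕ → Fin s) (N : ℕ) :
    cylLeft q α (N + 1) + cylLen q α (N + 1) =
      cylLeft q α N + (qbeta s q (α N) N + q (α N) N) * cylLen q α N := by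
  rw [cylLeft_succ, cylLen_succ]
  ring

lemma cylLen_congr {α γ : ℕ → Fin s} {N : ℕ} (h : ∀ n < N, α n = γ n) :
    cylLen q α N = cylLen q γ N :=
  Finset.prod_congr rfl fun j hj => by rw [h j (Finset.mem_range.1 hj)]

lemma cylLeft_congr {α γ : ℕ → Fin s} {N : ℕ} (h : ∀ n < N, α n = γ n) :
    cylLeft q α N = cylLeft q γ N :=
  Finset.sum_congr rfl fun j hj => by
    have hj := Finset.mem_range.1 hj
    rw [h j hj, cylLen_congr fun n hn => h n (hn.trans hj)]

lemma monotone_cylLeft (hq0 : ∀ i n, 0 < q i n) (α : ℕ → Fin s) : Monotone (cylLeft q α) :=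
  monotone_nat_of_le_succ fun n => by
    rw [cylLeft_succ]
    exact le_add_of_nonneg_right (mul_nonneg (qbeta_nonneg hq0 _ n) (cylLen_pos hq0 α n).le)

lemma antitone_cylRight (hq0 : ∀ i n, 0 < q i n) (hqsum : ∀ n, ∑ i : Fin s, q i n = 1)
    (α : ℕ → Fin s) : Antitone fun N => cylLeft q α N + cylLen q α N :=
  antitone_nat_of_succ_le fun n => by
    rw [cylRight_succ]
    have := mul_le_mul_of_nonneg_right (qbeta_add_le_one hq0 hqsum (α n) n)
      (cylLen_pos hq0 α n).le
    linarith

lemma tendsto_cylLeft (hq0 : ∀ i n, 0 < q i n) (hqsum : ∀ n, ∑ i : Fin s, q i n = 1)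
    (α : ℕ → Fin s) : Tendsto (cylLeft q α) atTop (𝓝 (Delta s q α)) := by
  refine Summable.tendsto_sum_tsum_nat (summable_of_sum_range_le (c := 1)
    (fun n => mul_nonneg (qbeta_nonneg hq0 _ n) (cylLen_pos hq0 α n).le) fun n => ?_)
  have h := antitone_cylRight hq0 hqsum α (Nat.zero_le n)
  have h0 : cylLeft q α 0 + cylLen q α 0 = 1 := by simp [cylLeft, cylLen]
  have h1 := (cylLen_pos hq0 α n).le
  change cylLeft q α n ≤ 1
  simp only [h0] at h
  linarith

lemma cylLen_le (hq0 : ∀ i n, 0 < q i n) (α : ℕ → Fin s) (N : ℕ) :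
    cylLen q α N ≤ ∏ n ∈ Finset.range N, ⨆ i : Fin s, q i n :=
  Finset.prod_le_prod (fun j _ => (hq0 _ j).le) fun j _ =>
    le_ciSup (f := fun i => q i j) (Set.finite_range _).bddAbove (α j)

lemma tendsto_cylRight (hq0 : ∀ i n, 0 < q i n) (hqsum : ∀ n, ∑ i : Fin s, q i n = 1)
    (hqprod : Tendsto (fun N => ∏ n ∈ Finset.range N, ⨆ i : Fin s, q i n) atTop (𝓝 0))
    (α : ℕ → Fin s) :
    Tendsto (fun N => cylLeft q α N + cylLen q α N) atTop (𝓝 (Delta s q α)) := by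
  have h := squeeze_zero (fun N => (cylLen_pos hq0 α N).le) (cylLen_le hq0 α) hqprod
  simpa using (tendsto_cylLeft hq0 hqsum α).add h

lemma cylLeft_le_Delta (hq0 : ∀ i n, 0 < q i n) (hqsum : ∀ n, ∑ i : Fin s, q i n = 1)
    (α : ℕ → Fin s) (N : ℕ) : cylLeft q α N ≤ Delta s q α :=
  (monotone_cylLeft hq0 α).ge_of_tendsto (tendsto_cylLeft hq0 hqsum α) N

lemma Delta_le_cylRight (hq0 : ∀ i n, 0 < q i n) (hqsum : ∀ n, ∑ i : Fin s, q i n = 1)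
    (hqprod : Tendsto (fun N => ∏ n ∈ Finset.range N, ⨆ i : Fin s, q i n) atTop (𝓝 0))
    (α : ℕ → Fin s) (N : ℕ) : Delta s q α ≤ cylLeft q α N + cylLen q α N :=
  (antitone_cylRight hq0 hqsum α).le_of_tendsto (tendsto_cylRight hq0 hqsum hqprod α) N

lemma Delta_mem_Icc (hq0 : ∀ i n, 0 < q i n) (hqsum : ∀ n, ∑ i : Fin s, q i n = 1)
    (hqprod : Tendsto (fun N => ∏ n ∈ Finset.range N, ⨆ i : Fin s, q i n) atTop (𝓝 0))
    (α : ℕ → Fin s) : Delta s q α ∈ Set.Icc (0 : ℝ) 1 := by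
  have h0 := cylLeft_le_Delta hq0 hqsum α 0
  have h1 := Delta_le_cylRight hq0 hqsum hqprod α 0
  simp only [cylLeft, cylLen, Finset.range_zero, Finset.sum_empty, Finset.prod_empty,
    zero_add] at h0 h1
  exact ⟨h0, h1⟩

lemma Delta_eq_cylLeft_iff (hq0 : ∀ i n, 0 < q i n) (hqsum : ∀ n, ∑ i : Fin s, q i n = 1)
    (α : ℕ → Fin s) (N : ℕ) :
    Delta s q α = cylLeft q α N ↔ ∀ n ≥ N, (α n : ℕ) = 0 := by
  constructor
  · intro h n hn
    by_contra hne
    have h1 := cylLeft_le_Delta hq0 hqsum α (n + 1)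
    have h2 := monotone_cylLeft hq0 α hn
    have h3 := mul_pos (qbeta_pos hq0 hne n) (cylLen_pos hq0 α n)
    rw [cylLeft_succ] at h1
    linarith
  · intro h
    refine tendsto_nhds_unique (tendsto_cylLeft hq0 hqsum α)
      (tendsto_const_nhds.congr' ?_)
    filter_upwards [eventually_ge_atTop N] with n hn
    induction n, hn using Nat.le_induction with
    | base => rfl
    | succ n hn ih => rw [cylLeft_succ, qbeta_eq_zero (h n hn), zero_mul, add_zero, ih]

lemma Delta_eq_cylRight_iff (hq0 : ∀ i n, 0 < q i n) (hqsum : ∀ n, ∑ i : Fin s, q i n = 1)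
    (hqprod : Tendsto (fun N => ∏ n ∈ Finset.range N, ⨆ i : Fin s, q i n) atTop (𝓝 0))
    (α : ℕ → Fin s) (N : ℕ) :
    Delta s q α = cylLeft q α N + cylLen q α N ↔ ∀ n ≥ N, (α n : ℕ) + 1 = s := by
  constructor
  · intro h n hn
    by_contra hne
    have h1 := Delta_le_cylRight hq0 hqsum hqprod α (n + 1)
    have h2 := antitone_cylRight hq0 hqsum α hn
    have h3 := mul_lt_mul_of_pos_right (qbeta_add_lt_one hq0 hqsum hne n) (cylLen_pos hq0 α n)
    rw [cylRight_succ] at h1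
    simp only at h2
    linarith
  · intro h
    refine tendsto_nhds_unique (tendsto_cylRight hq0 hqsum hqprod α)
      (tendsto_const_nhds.congr' ?_)
    filter_upwards [eventually_ge_atTop N] with n hn
    induction n, hn using Nat.le_induction with
    | base => rfl
    | succ n hn ih => rw [cylRight_succ, qbeta_add_eq_one hqsum (h n hn), one_mul, ih]

/-- Two digit sequences that first differ at position `m` represent the same number iff they
are the two representations of a `Q*_s`-binary number. -/
lemma Delta_eq_iff_of_lt (hq0 : ∀ i n, 0 < q i n) (hqsum : ∀ n, ∑ i : Fin s, q i n = 1)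
    (hqprod : Tendsto (fun N => ∏ n ∈ Finset.range N, ⨆ i : Fin s, q i n) atTop (𝓝 0))
    {γ δ : ℕ → Fin s} {m : ℕ} (h : ∀ n < m, γ n = δ n) (hlt : γ m < δ m) :
    Delta s q γ = Delta s q δ ↔
      (γ m : ℕ) + 1 = δ m ∧ ∀ n > m, (γ n : ℕ) + 1 = s ∧ (δ n : ℕ) = 0 := by
  have hγ := Delta_le_cylRight hq0 hqsum hqprod γ (m + 1)
  have hδ := cylLeft_le_Delta hq0 hqsum δ (m + 1)
  have hγ' := Delta_eq_cylRight_iff hq0 hqsum hqprod γ (m + 1)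
  have hδ' := Delta_eq_cylLeft_iff hq0 hqsum δ (m + 1)
  have hP := cylLen_pos hq0 δ m
  rw [cylRight_succ, cylLeft_congr h, cylLen_congr h] at hγ hγ'
  rw [cylLeft_succ] at hδ hδ'
  have hle := mul_le_mul_of_nonneg_right (qbeta_add_le_qbeta hq0 hlt m) hP.le
  constructor
  · intro heq
    have hm : (γ m : ℕ) + 1 = δ m := by
      by_contra hne
      have hlt' : (γ m : ℕ) + 1 < δ m := by
        have := Fin.lt_def.1 hlt
        omega
      have := mul_lt_mul_of_pos_right (qbeta_add_lt_qbeta hq0 hlt' m) hP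
      linarith
    exact ⟨hm, fun n hn => ⟨hγ'.1 (by linarith) n hn, hδ'.1 (by linarith) n hn⟩⟩
  · rintro ⟨hm, ht⟩
    rw [hγ'.2 fun n hn => (ht n hn).1, hδ'.2 fun n hn => (ht n hn).2, qbeta_add_eq_qbeta hm]

lemma exists_first_ne {γ δ : ℕ → Fin s} (h : γ ≠ δ) : ∃ m, (∀ n < m, γ n = δ n) ∧ γ m ≠ δ m := by
  classical
  have h' := Function.ne_iff.1 h
  exact ⟨Nat.find h', fun n hn => not_not.1 (Nat.find_min h' hn), Nat.find_spec h'⟩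

/-- A number has at most one representation that is not eventually `s - 1`. -/
lemma eq_of_Delta_eq (hq0 : ∀ i n, 0 < q i n) (hqsum : ∀ n, ∑ i : Fin s, q i n = 1)
    (hqprod : Tendsto (fun N => ∏ n ∈ Finset.range N, ⨆ i : Fin s, q i n) atTop (𝓝 0))
    {γ δ : ℕ → Fin s} (hγ : ¬ ∃ N, ∀ n ≥ N, (γ n : ℕ) = s - 1)
    (hδ : ¬ ∃ N, ∀ n ≥ N, (δ n : ℕ) = s - 1) (h : Delta s q γ = Delta s q δ) : γ = δ := by
  by_contra hne
  obtain ⟨m, hm, hmne⟩ := exists_first_ne hne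
  rcases lt_or_gt_of_ne hmne with hlt | hlt
  · have := ((Delta_eq_iff_of_lt hq0 hqsum hqprod hm hlt).1 h).2
    exact hγ ⟨m + 1, fun n hn => Nat.eq_sub_of_add_eq (this n hn).1⟩
  · have := ((Delta_eq_iff_of_lt hq0 hqsum hqprod (fun n hn => (hm n hn).symm) hlt).1 h.symm).2
    exact hδ ⟨m + 1, fun n hn => Nat.eq_sub_of_add_eq (this n hn).1⟩

lemma continuous_cylLeft (N : ℕ) : Continuous fun α : ℕ → Fin s => cylLeft q α N := by
  refine continuous_finsetSum _ fun n _ =>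
    Continuous.mul ?_ (continuous_finsetProd _ fun j _ => ?_)
  · exact (continuous_of_discreteTopology (f := fun k => qbeta s q k n)).comp (continuous_apply n)
  · exact (continuous_of_discreteTopology (f := fun k => q k j)).comp (continuous_apply j)

lemma continuous_Delta (hq0 : ∀ i n, 0 < q i n) (hqsum : ∀ n, ∑ i : Fin s, q i n = 1)
    (hqprod : Tendsto (fun N => ∏ n ∈ Finset.range N, ⨆ i : Fin s, q i n) atTop (𝓝 0)) :
    Continuous (Delta s q) := by
  refine TendstoUniformly.continuous (F := fun N α => cylLeft q α N) (p := atTop) ?_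
    (Frequently.of_forall continuous_cylLeft)
  rw [Metric.tendstoUniformly_iff]
  intro ε hε
  filter_upwards [hqprod.eventually (gt_mem_nhds hε)] with N hN α
  have h1 := cylLeft_le_Delta hq0 hqsum α N
  have h2 := Delta_le_cylRight hq0 hqsum hqprod α N
  have h3 := cylLen_le hq0 α N
  rw [Real.dist_eq, abs_of_nonneg (by linarith)]
  linarith

lemma continuous_adiff (a : ℕ → Fin s) :
    Continuous fun (γ : ℕ → Fin s) n => adiff (a n) (γ n) :=
  continuous_pi fun n =>
    (continuous_of_discreteTopology (f := fun k => adiff (a n) k)).comp (continuous_apply n)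

/-- If `f` is obtained from a continuous function `g` of digit sequences by choosing
representations, then `f` is continuous wherever `g` does not depend on the representation. -/
lemma continuousWithinAt_of_representations {X : Type*} [TopologicalSpace X] [CompactSpace X]
    {Φ g : X → ℝ} (hΦ : Continuous Φ) (hg : Continuous g) {f : ℝ → ℝ} {S : Set ℝ} {D : ℝ → X}
    (hD : ∀ y ∈ S, Φ (D y) = y) (hf : ∀ y, f y = g (D y)) {x : ℝ}
    (h : ∀ γ, Φ γ = x → g γ = f x) : ContinuousWithinAt f S x := by
  intro U hU
  obtain ⟨V, hVU, hVo, hxV⟩ := mem_nhds_iff.1 hU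
  have hcl : IsClosed (Φ '' (g ⁻¹' Vᶜ)) :=
    ((hVo.isClosed_compl.preimage hg).isCompact.image hΦ).isClosed
  have hx : x ∉ Φ '' (g ⁻¹' Vᶜ) := by
    rintro ⟨γ, hγ, rfl⟩
    exact hγ (h γ rfl ▸ hxV)
  rw [mem_map]
  filter_upwards [mem_nhdsWithin_of_mem_nhds (hcl.isOpen_compl.mem_nhds hx),
    self_mem_nhdsWithin] with y hy hyS
  refine hVU (by_contra fun hyV => hy ⟨D y, ?_, hD y hyS⟩)
  simpa [← hf] using hyV

/-- Replacing all digits by their complements to `s - 1` respects equality of numbers. -/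
lemma Delta_adiff_top_congr (hq0 : ∀ i n, 0 < q i n) (hqsum : ∀ n, ∑ i : Fin s, q i n = 1)
    (hqprod : Tendsto (fun N => ∏ n ∈ Finset.range N, ⨆ i : Fin s, q i n) atTop (𝓝 0))
    {a : ℕ → Fin s} (ha : ∀ n, (a n : ℕ) + 1 = s) {γ δ : ℕ → Fin s}
    (h : Delta s q γ = Delta s q δ) :
    Delta s q (fun n => adiff (a n) (γ n)) = Delta s q (fun n => adiff (a n) (δ n)) := by
  by_cases hne : γ = δ
  · rw [hne]
  obtain ⟨m, hm, hmne⟩ := exists_first_ne hne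
  wlog hlt : γ m < δ m generalizing γ δ
  · exact (this h.symm (Ne.symm hne) (fun n hn => (hm n hn).symm) hmne.symm
      (lt_of_le_of_ne (not_lt.1 hlt) hmne.symm)).symm
  obtain ⟨h1, h2⟩ := (Delta_eq_iff_of_lt hq0 hqsum hqprod hm hlt).1 h
  have hval (k : ℕ) (β : ℕ → Fin s) : (adiff (a k) (β k) : ℕ) + β k + 1 = s := by
    have := (β k).2
    have := ha k
    simp only [adiff]
    omega
  have hγm := hval m γ
  have hδm := hval m δ
  refine ((Delta_eq_iff_of_lt hq0 hqsum hqprod (m := m) (fun n hn => ?_) ?_).2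
    ⟨?_, fun n hn => ⟨?_, ?_⟩⟩).symm
  · simp only [hm n hn]
  · rw [Fin.lt_def]
    omega
  · omega
  · have := hval n δ
    have := h2 n hn
    omega
  · have := hval n γ
    have := h2 n hn
    omega

lemma hasSum_sub_one_div_pow (hs : 2 ≤ s) :
    HasSum (fun n : ℕ => ((s : ℝ) - 1) / (s : ℝ) ^ (n + 1)) 1 := by
  have hs' : (2 : ℝ) ≤ s := by exact_mod_cast hs
  have h := (hasSum_geometric_of_lt_one (r := (s : ℝ)⁻¹) (by positivity)
    (inv_lt_one_of_one_lt₀ (by linarith))).mul_left (((s : ℝ) - 1) / s)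
  have hs1 : (s : ℝ) - 1 ≠ 0 := by linarith
  have hs0 : (s : ℝ) ≠ 0 := by linarith
  have h1 : ((s : ℝ) - 1) / s * (1 - (s : ℝ)⁻¹)⁻¹ = 1 := by
    rw [show 1 - (s : ℝ)⁻¹ = ((s : ℝ) - 1) / s by field_simp]
    exact mul_inv_cancel₀ (div_ne_zero hs1 hs0)
  rw [h1] at h
  refine (congrArg (HasSum · 1) (funext fun n => ?_)).mp h
  rw [inv_pow, pow_succ]
  field_simp

lemma sadic_digit_le (a : Fin s) (n : ℕ) :
    (a : ℝ) / (s : ℝ) ^ (n + 1) ≤ ((s : ℝ) - 1) / (s : ℝ) ^ (n + 1) := by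
  have : ((a : ℕ) : ℝ) + 1 ≤ s := by exact_mod_cast a.2
  gcongr
  linarith

lemma summable_sadic (hs : 2 ≤ s) (a : ℕ → Fin s) :
    Summable fun n : ℕ => (a n : ℝ) / (s : ℝ) ^ (n + 1) :=
  Summable.of_nonneg_of_le (fun n => by positivity) (fun n => sadic_digit_le (a n) n)
    (hasSum_sub_one_div_pow hs).summable

lemma sadic_eq_zero (hs : 2 ≤ s) {a : ℕ → Fin s}
    (h : ∑' n : ℕ, (a n : ℝ) / (s : ℝ) ^ (n + 1) = 0) (n : ℕ) : (a n : ℕ) = 0 := by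
  have hsum := (summable_sadic hs a).hasSum
  rw [h, hasSum_zero_iff_of_nonneg (fun n => by positivity)] at hsum
  have hn := congrFun hsum n
  have : s ≠ 0 := by omega
  simpa [this] using hn

lemma sadic_eq_one (hs : 2 ≤ s) {a : ℕ → Fin s}
    (h : ∑' n : ℕ, (a n : ℝ) / (s : ℝ) ^ (n + 1) = 1) (n : ℕ) : (a n : ℕ) + 1 = s := by
  have hsum := (hasSum_sub_one_div_pow hs).sub (summable_sadic hs a).hasSum
  rw [h, sub_self, hasSum_zero_iff_of_nonneg fun n => sub_nonneg.2 (sadic_digit_le (a n) n)]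
    at hsum
  have hn := congrFun hsum n
  have hs0 : (s : ℝ) ≠ 0 := by
    have : s ≠ 0 := by omega
    exact_mod_cast this
  rw [Pi.zero_apply, ← sub_div, div_eq_zero_iff, or_iff_left (pow_ne_zero _ hs0)] at hn
  have : ((a n : ℕ) : ℝ) + 1 = s := by linarith
  exact_mod_cast this

/-- If `f_a` is continuous and `a` is not eventually `s - 1`, all digits of `a` vanish: otherwise,
at a digit `a_m ≥ 1`, the two representations of `Δ(0 … 0 1 0 0 …)` give different values. -/
lemma digit_eq_zero_of_continuousOn (hs : 2 ≤ s) (hq0 : ∀ i n, 0 < q i n)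
    (hqsum : ∀ n, ∑ i : Fin s, q i n = 1)
    (hqprod : Tendsto (fun N => ∏ n ∈ Finset.range N, ⨆ i : Fin s, q i n) atTop (𝓝 0))
    {D : ℝ → ℕ → Fin s}
    (hDuniq : ∀ γ : ℕ → Fin s, (¬ ∃ N, ∀ n ≥ N, (γ n : ℕ) = s - 1) → D (Delta s q γ) = γ)
    {a : ℕ → Fin s} (ha : ¬ ∃ N, ∀ n ≥ N, (a n : ℕ) = s - 1) {f : ℝ → ℝ}
    (hf : ∀ x, f x = Delta s q (fun n => adiff (a n) (D x n)))
    (hc : ContinuousOn f (Set.Icc 0 1)) (m : ℕ) : (a m : ℕ) = 0 := by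
  by_contra hm
  let z : Fin s := ⟨0, by omega⟩
  let t : Fin s := ⟨s - 1, by omega⟩
  let γ : ℕ → Fin s := fun n => if n = m then ⟨1, by omega⟩ else z
  let δ : ℕ → Fin s := fun n => if n ≤ m then z else t
  let δ' : ℕ → ℕ → Fin s := fun k n => if n ≤ k then δ n else z
  have hz : (z : ℕ) ≠ s - 1 := by simp only [z]; omega
  have hγD : D (Delta s q γ) = γ := hDuniq γ fun ⟨N, hN⟩ => hz (by
    simpa [γ, show N + m + 1 ≠ m by omega] using hN (N + m + 1) (by omega))
  have hδD (k : ℕ) : D (Delta s q (δ' k)) = δ' k := hDuniq _ fun ⟨N, hN⟩ => hz (by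
    simpa [δ', show ¬ N + k + 1 ≤ k by omega] using hN (N + k + 1) (by omega))
  have hlim : Tendsto δ' atTop (𝓝 δ) := by
    refine tendsto_pi_nhds.2 fun n => tendsto_const_nhds.congr' ?_
    filter_upwards [eventually_ge_atTop n] with k hk
    simp [δ', hk]
  have hΔ := continuous_Delta hq0 hqsum hqprod
  have heq : Delta s q δ = Delta s q γ := by
    refine (Delta_eq_iff_of_lt hq0 hqsum hqprod (m := m) (fun n hn => ?_) ?_).2
      ⟨?_, fun n hn => ⟨?_, ?_⟩⟩
    · simp [γ, δ, hn.le, hn.ne]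
    · simp [γ, δ, z, Fin.lt_def]
    · simp [γ, δ, z]
    · simp only [δ, not_le.2 hn, if_false, t]
      omega
    · simp [γ, (show n ≠ m from hn.ne'), z]
  have hx : Tendsto (fun k => Delta s q (δ' k)) atTop (𝓝[Set.Icc 0 1] (Delta s q γ)) := by
    refine tendsto_nhdsWithin_iff.2 ⟨?_, Eventually.of_forall fun k =>
      Delta_mem_Icc hq0 hqsum hqprod _⟩
    rw [← heq]
    exact (hΔ.tendsto δ).comp hlim
  have h1 := (hc _ (Delta_mem_Icc hq0 hqsum hqprod γ)).tendsto.comp hx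
  have h2 := ((hΔ.comp (continuous_adiff a)).tendsto δ).comp hlim
  have h3 := tendsto_nhds_unique h1 (h2.congr fun k => by simp [hf, hδD])
  rw [hf, hγD] at h3
  refine ha ⟨m + 1, fun n hn => ?_⟩
  have htail :=
    (((Delta_eq_iff_of_lt hq0 hqsum hqprod (m := m) (fun k hk => ?_) ?_).1 h3).2 n hn).1
  · simp only [γ, (show n ≠ m by omega), if_false, adiff, z] at htail
    omega
  · simp [γ, δ, hk.le, hk.ne]
  · simp only [γ, δ, adiff, z, if_true, le_refl, Fin.lt_def]
    omega

end QStar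

/-- f_a is continuous on all of [0,1] iff a = 0 or a = 1; moreover every
point of discontinuity of f_a in [0,1] is a Q*_s-binary number. -/
theorem stmt10 (s : ℕ) (hs : 2 ≤ s) (q : Fin s → ℕ → ℝ)
    (hq0 : ∀ i n, 0 < q i n) (hq1 : ∀ i n, q i n < 1)
    (hqsum : ∀ n, ∑ i : Fin s, q i n = 1)
    (hqprod : Filter.Tendsto (fun N => ∏ n ∈ Finset.range N, ⨆ i : Fin s, q i n)
      Filter.atTop (nhds 0))
    (D : ℝ → ℕ → Fin s)
    (hD : ∀ x ∈ Set.Icc (0 : ℝ) 1, Delta s q (D x) = x)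
    (hDcanon : ∀ x ∈ Set.Icc (0 : ℝ) 1, x ≠ 1 → ¬ ∃ N, ∀ n ≥ N, ((D x n : ℕ) = s - 1))
    (hD1 : ∀ n, ((D 1 n : ℕ) = s - 1))
    (a : ℝ) (ha : a ∈ Set.Icc (0 : ℝ) 1) (aseq : ℕ → Fin s)
    (haseq : a = ∑' n : ℕ, (aseq n : ℝ) / (s : ℝ) ^ (n + 1))
    (hacanon : a ≠ 1 → ¬ ∃ N, ∀ n ≥ N, ((aseq n : ℕ) = s - 1))
    (f : ℝ → ℝ) (hf : ∀ x, f x = Delta s q (fun n => adiff (aseq n) (D x n))) :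
    (ContinuousOn f (Set.Icc 0 1) ↔ (a = 0 ∨ a = 1)) ∧
      (∀ x ∈ Set.Icc (0 : ℝ) 1, ¬ ContinuousWithinAt f (Set.Icc 0 1) x →
        ∃ γ δ : ℕ → Fin s, γ ≠ δ ∧ Delta s q γ = x ∧ Delta s q δ = x) := by
  have hΔ := continuous_Delta hq0 hqsum hqprod
  have hg : Continuous fun γ : ℕ → Fin s => Delta s q (fun n => adiff (aseq n) (γ n)) :=
    hΔ.comp (continuous_adiff aseq)
  refine ⟨⟨fun hc => ?_, ?_⟩, fun x hx hnc => ?_⟩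
  · by_contra! hne
    refine hne.1 ?_
    have hDuniq (γ : ℕ → Fin s) (hγ : ¬ ∃ N, ∀ n ≥ N, (γ n : ℕ) = s - 1) :
        D (Delta s q γ) = γ := by
      have hmem := Delta_mem_Icc hq0 hqsum hqprod γ
      refine eq_of_Delta_eq hq0 hqsum hqprod (hDcanon _ hmem fun h1 => hγ ⟨0, fun n hn => ?_⟩) hγ
        (hD _ hmem)
      have := (Delta_eq_cylRight_iff hq0 hqsum hqprod γ 0).1 (by simpa [cylLeft, cylLen]) n hn
      omega
    have hzero := digit_eq_zero_of_continuousOn hs hq0 hqsum hqprod hDuniq (hacanon hne.2) hf hc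
    simp [haseq, hzero]
  · rintro h x hx
    refine continuousWithinAt_of_representations hΔ hg hD hf fun γ hγ => ?_
    rw [hf]
    rcases h with h | h
    · have hadiff (β : ℕ → Fin s) : (fun n => adiff (aseq n) (β n)) = β := by
        funext n
        ext
        simp [adiff, sadic_eq_zero hs (haseq.symm.trans h) n]
      simp only [hadiff]
      rw [hγ, hD x hx]
    · exact Delta_adiff_top_congr hq0 hqsum hqprod (sadic_eq_one hs (haseq.symm.trans h))
        (hγ.trans (hD x hx).symm)
  · by_contra! hno
    refine hnc (continuousWithinAt_of_representations hΔ hg hD hf fun γ hγ => ?_)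
    rw [hf, show γ = D x from by_contra fun hne => hno γ (D x) hne hγ (hD x hx)]
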